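/- Let M be a countable set and G ≤ Sym(M) a permutation group with no algebraicity. Let Ω = [0,1]^M carry the product σ-algebra and the shift action, and let μ be a G-invariant Borel probability measure on Ω. Then the dynamical tail σ-field T equals the usual tail σ-field T₀ up to μ-null sets: every T-measurable event differs by a μ-null set from a T₀-measurable event, and conversely. -/

import Mathlib

open MeasureTheory ProbabilityTheory

/-- The shift action of a permutation `g` of `M` on configurations `ω : M → [0,1]`:
`(g · ω)(a) = ω (g⁻¹ a)`. -/
def shiftAct {M : Type*} (g : Equiv.Perm M) (ω : M → unitInterval) : M → unitInterval :=
  fun a => ω (g⁻¹ a)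

/-- The σ-field generated by the coordinate projection `ξ_a`. -/
def coordField {M : Type*} (a : M) : MeasurableSpace (M → unitInterval) :=
  MeasurableSpace.comap (fun ω => ω a) inferInstance

/-- The usual tail σ-field `T₀ = ⋂ {σ(ξ_a : a ∉ A) : A finite}`. -/
def tailField (M : Type*) : MeasurableSpace (M → unitInterval) :=
  ⨅ A : Finset M, ⨆ (a : M) (_ : a ∉ A), coordField a

/-- The σ-field `F_A` of events invariant (mod `μ`-null sets) under the pointwise
stabilizer `G_{(A)}`. -/
def invField {M : Type*} (G : Subgroup (Equiv.Perm M)) (μ : Measure (M → unitInterval))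
    (A : Set M) : MeasurableSpace (M → unitInterval) :=
  MeasurableSpace.generateFrom
    {s : Set (M → unitInterval) | MeasurableSet s ∧
      ∀ g ∈ G, (∀ a ∈ A, g a = a) → μ (symmDiff (shiftAct g ⁻¹' s) s) = 0}

/-- For arbitrary `D ⊆ M`, the σ-field `F_D` generated by the `F_A` for finite `A ⊆ D`. -/
def invFieldOf {M : Type*} (G : Subgroup (Equiv.Perm M)) (μ : Measure (M → unitInterval))
    (D : Set M) : MeasurableSpace (M → unitInterval) :=
  ⨆ (A : Finset M) (_ : (A : Set M) ⊆ D), invField G μ (A : Set M)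

/-- The dynamical tail σ-field `T = ⋂ {F_{M ∖ A} : A ⊆ M finite}`. -/
def dynTailField {M : Type*} (G : Subgroup (Equiv.Perm M))
    (μ : Measure (M → unitInterval)) : MeasurableSpace (M → unitInterval) :=
  ⨅ A : Finset M, invFieldOf G μ ((A : Set M)ᶜ)

open Filter Set
open scoped symmDiff

theorem measurable_shiftAct {M : Type*} (g : Equiv.Perm M) : Measurable (shiftAct g) :=
  measurable_pi_lambda _ fun a => measurable_pi_apply (g⁻¹ a)

/-- Mod-null measurability passes to limits in measure. -/
theorem exists_measurableSet_ae_eq_of_approx {Ω : Type*} {m m₀ : MeasurableSpace Ω}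
    {μ : @Measure Ω m₀} {s : Set Ω}
    (h : ∀ ε : ℝ, 0 < ε → ∃ t, MeasurableSet[m] t ∧ μ (t ∆ s) < ENNReal.ofReal ε) :
    ∃ t, MeasurableSet[m] t ∧ s =ᵐ[μ] t := by
  choose t ht hts using fun n : ℕ => h ((1 / 2) ^ n) (by positivity)
  refine ⟨limsup t atTop, @MeasurableSet.measurableSet_limsup _ m _ ht, ?_⟩
  have hsum : ∑' n, μ (t n ∆ s) ≠ ⊤ :=
    ne_top_of_le_ne_top summable_geometric_two.tsum_ofReal_ne_top
      (ENNReal.tsum_le_tsum fun n => (hts n).le)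
  filter_upwards [ae_eventually_notMem hsum] with ω hω
  have hev : ∀ᶠ n in atTop, (ω ∈ t n ↔ ω ∈ s) := by
    filter_upwards [hω] with n hn
    rw [mem_symmDiff] at hn
    tauto
  apply propext
  change ω ∈ s ↔ ω ∈ limsup t atTop
  rw [mem_limsup_iff_frequently_mem, frequently_congr hev, frequently_const]

/-- A finite set can be moved off a finite set `A` by the stabilizer of a set disjoint from `A`. -/
theorem exists_forall_apply_notMem {M : Type*} {G : Subgroup (Equiv.Perm M)}
    (hnoalg : ∀ A : Set M, A.Finite → ∀ b ∉ A,
      {c : M | ∃ g ∈ G, (∀ a ∈ A, g a = a) ∧ g b = c}.Infinite)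
    {A B : Finset M} (hAB : Disjoint A B) (C : Finset M) :
    ∃ g ∈ G, (∀ b ∈ B, g b = b) ∧ ∀ c ∈ C, g c ∉ A := by
  classical
  induction C using Finset.induction_on with
  | empty => exact ⟨1, G.one_mem, by simp, by simp⟩
  | insert c C _ ih =>
    obtain ⟨g, hg, hgB, hgC⟩ := ih
    by_cases hc : g c ∈ B ∪ C.image g
    · refine ⟨g, hg, hgB, fun d hd => ?_⟩
      rcases Finset.mem_insert.1 hd with rfl | hd
      · rcases Finset.mem_union.1 hc with h | h
        · exact Finset.disjoint_right.1 hAB h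
        · obtain ⟨e, he, hed⟩ := Finset.mem_image.1 h
          exact hed ▸ hgC e he
      · exact hgC d hd
    · obtain ⟨d, ⟨k, hk, hkfix, rfl⟩, hd⟩ :=
        (hnoalg (↑(B ∪ C.image g)) (Finset.finite_toSet _) (g c)
          (by exact_mod_cast hc)).exists_notMem_finset A
      refine ⟨k * g, G.mul_mem hk hg, fun b hb => ?_, fun d' hd' => ?_⟩
      · rw [Equiv.Perm.mul_apply, hgB b hb]
        exact hkfix b (Finset.mem_coe.2 (Finset.mem_union_left _ hb))
      · rcases Finset.mem_insert.1 hd' with rfl | hd'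
        · exact hd
        · rw [Equiv.Perm.mul_apply,
            hkfix (g d') (Finset.mem_coe.2 (Finset.mem_union_right _
              (Finset.mem_image_of_mem g hd')))]
          exact hgC d' hd'

theorem measurableSet_preimage_shiftAct_cylinder {M : Type*} {g : Equiv.Perm M}
    {A C : Finset M} (hg : ∀ c ∈ C, g⁻¹ c ∉ A) {S : Set (C → unitInterval)}
    (hS : MeasurableSet S) :
    MeasurableSet[⨆ (a : M) (_ : a ∉ A), coordField a]
      (shiftAct g ⁻¹' cylinder (α := fun _ => unitInterval) C S) := by
  have hmeas : Measurable[⨆ (a : M) (_ : a ∉ A), coordField a]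
      (fun (ω : M → unitInterval) (c : C) => ω (g⁻¹ c)) := by
    refine @measurable_pi_lambda _ _ _ (_) _ _ fun c => ?_
    exact (comap_measurable fun ω : M → unitInterval => ω (g⁻¹ c)).mono
      (le_iSup₂_of_le (g⁻¹ c) (hg c c.2) le_rfl) le_rfl
  exact hmeas hS

/-- Events generated by those invariant under stabilizers of sets disjoint from `A` are, mod null
sets, determined by the coordinates outside `A`. -/
theorem invFieldOf_compl_le_eventuallyMeasurableSpace {M : Type*}
    {G : Subgroup (Equiv.Perm M)}
    (hnoalg : ∀ A : Set M, A.Finite → ∀ b ∉ A,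
      {c : M | ∃ g ∈ G, (∀ a ∈ A, g a = a) ∧ g b = c}.Infinite)
    {μ : Measure (M → unitInterval)} [IsProbabilityMeasure μ]
    (hinv : ∀ g ∈ G, μ.map (shiftAct g) = μ) (A : Finset M) :
    invFieldOf G μ ((A : Set M)ᶜ) ≤
      eventuallyMeasurableSpace (⨆ (a : M) (_ : a ∉ A), coordField a) (ae μ) := by
  refine iSup₂_le fun B hB => MeasurableSpace.generateFrom_le fun s ⟨hs, hsinv⟩ => ?_
  have hAB : Disjoint A B := Finset.disjoint_right.2 fun b hb => hB (Finset.mem_coe.2 hb)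
  refine exists_measurableSet_ae_eq_of_approx fun ε hε => ?_
  obtain ⟨t, ht, hst⟩ := (Measure.MeasureDense.of_generateFrom_isSetAlgebra_finite (μ := μ)
    (isSetAlgebra_measurableCylinders (α := fun _ : M => unitInterval))
    generateFrom_measurableCylinders.symm).approx s hs (measure_ne_top μ s) ε hε
  obtain ⟨C, S, hS, rfl⟩ := (mem_measurableCylinders t).1 ht
  obtain ⟨g, hg, hgB, hgC⟩ := exists_forall_apply_notMem hnoalg hAB C
  refine ⟨shiftAct g⁻¹ ⁻¹' cylinder C S,
    measurableSet_preimage_shiftAct_cylinder (by simpa using hgC) hS, ?_⟩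
  have hg' := G.inv_mem hg
  have hpres : MeasurePreserving (shiftAct g⁻¹) μ μ := ⟨measurable_shiftAct _, hinv _ hg'⟩
  have hfix : μ ((shiftAct g⁻¹ ⁻¹' s) ∆ s) = 0 :=
    hsinv _ hg' fun b hb => Equiv.Perm.inv_eq_iff_eq.2 (hgB b hb).symm
  calc μ ((shiftAct g⁻¹ ⁻¹' cylinder C S) ∆ s)
      ≤ μ ((shiftAct g⁻¹ ⁻¹' cylinder C S) ∆ (shiftAct g⁻¹ ⁻¹' s))
        + μ ((shiftAct g⁻¹ ⁻¹' s) ∆ s) := measure_symmDiff_le _ _ _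
    _ = μ (s ∆ cylinder C S) := by
      rw [hfix, add_zero, ← preimage_symmDiff, symmDiff_comm,
        hpres.measure_preimage (hs.symmDiff (hS.cylinder C)).nullMeasurableSet]
    _ < ENNReal.ofReal ε := hst

theorem exists_tailField_ae_eq {M : Type*} [Countable M] {μ : Measure (M → unitInterval)}
    {E : Set (M → unitInterval)}
    (hE : ∀ A : Finset M, ∃ t, MeasurableSet[⨆ (a : M) (_ : a ∉ A), coordField a] t ∧
      E =ᵐ[μ] t) :
    ∃ t, MeasurableSet[tailField M] t ∧ E =ᵐ[μ] t := by
  choose t ht hEt using hE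
  obtain ⟨u, hu⟩ := exists_seq_tendsto (atTop : Filter (Finset M))
  refine ⟨limsup (fun n => t (u n)) atTop, ?_,
    (limsup_ae_eq_of_forall_ae_eq _ fun n => (hEt (u n)).symm).symm⟩
  refine MeasurableSpace.measurableSet_iInf.2 fun A => ?_
  obtain ⟨N, hN⟩ := eventually_atTop.1 (hu.eventually_ge_atTop A)
  rw [← limsup_nat_add _ N]
  have hle (n : ℕ) :
      (⨆ (a : M) (_ : a ∉ u (n + N)), coordField a) ≤ ⨆ (a : M) (_ : a ∉ A), coordField a :=
    biSup_mono fun a ha haA => ha (hN _ (Nat.le_add_left N n) haA)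
  exact @MeasurableSet.measurableSet_limsup _ (_) _ fun n => hle n _ (ht _)

theorem coordField_le_invField {M : Type*} (G : Subgroup (Equiv.Perm M))
    (μ : Measure (M → unitInterval)) (a : M) : coordField a ≤ invField G μ {a} := by
  rintro _ ⟨S, hS, rfl⟩
  refine MeasurableSpace.measurableSet_generateFrom
    ⟨measurable_pi_apply a hS, fun g _ hg => ?_⟩
  have hga : g⁻¹ a = a := Equiv.Perm.inv_eq_iff_eq.2 (hg a rfl).symm
  have : shiftAct g ⁻¹' ((fun ω : M → unitInterval => ω a) ⁻¹' S) = (fun ω => ω a) ⁻¹' S := by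
    ext ω
    simp [shiftAct, hga]
  simp [this]

theorem tailField_le_dynTailField {M : Type*} (G : Subgroup (Equiv.Perm M))
    (μ : Measure (M → unitInterval)) : tailField M ≤ dynTailField G μ := by
  refine iInf_mono fun A => iSup₂_le fun a ha => ?_
  refine le_iSup₂_of_le {a} (by simpa using ha) ?_
  simpa using coordField_le_invField G μ a

/-- if `G ↷ M` has no algebraicity, then for any `G`-invariant probability
measure on `[0,1]^M`, the dynamical tail σ-field `T` equals the usual tail σ-field `T₀`
up to `μ`-null sets. -/
theorem dynTail_eq_tail_ae
    {M : Type*} [Countable M] (G : Subgroup (Equiv.Perm M))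
    (hnoalg : ∀ A : Set M, A.Finite → ∀ b ∉ A,
      {c : M | ∃ g ∈ G, (∀ a ∈ A, g a = a) ∧ g b = c}.Infinite)
    (μ : Measure (M → unitInterval)) [IsProbabilityMeasure μ]
    (hinv : ∀ g ∈ G, μ.map (shiftAct g) = μ) :
    (∀ E : Set (M → unitInterval), MeasurableSet[dynTailField G μ] E →
        ∃ E' : Set (M → unitInterval), MeasurableSet[tailField M] E' ∧
          μ (symmDiff E E') = 0) ∧
    (∀ E : Set (M → unitInterval), MeasurableSet[tailField M] E →
        ∃ E' : Set (M → unitInterval), MeasurableSet[dynTailField G μ] E' ∧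
          μ (symmDiff E E') = 0) := by
  refine ⟨fun E hE => ?_, fun E hE => ⟨E, tailField_le_dynTailField G μ E hE, by simp⟩⟩
  obtain ⟨E', hE', hEE'⟩ := exists_tailField_ae_eq (μ := μ) fun A =>
    invFieldOf_compl_le_eventuallyMeasurableSpace hnoalg hinv A E
      (MeasurableSpace.measurableSet_iInf.1 hE A)
  exact ⟨E', hE', measure_symmDiff_eq_zero_iff.2 hEE'⟩
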